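/- arXiv:2007.06399 — 2 statements merged into one kernel-verified Lean document; each statement's English description precedes it below -/
import Mathlib

section
/- Let T be a tree of diameter 5 with vertex set {v_1, ..., v_n}, and let s_1, ..., s_n be integers with s_i ≥ 2 for all i. Then 5 ≤ d̄(T(s_1, ..., s_n)) ≤ 6; that is, T(s_1, ..., s_n) belongs to the class C_0 ∪ C_1. -/
open SimpleGraph

variable {V : Type*}

/-- `D` is an orientation of `G`: every arc of `D` is an edge of `G`, and every edge of `G`
receives exactly one of the two possible directions. -/
def IsOrientation (G : SimpleGraph V) (D : V → V → Prop) : Prop :=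
  (∀ u v, D u v → G.Adj u v) ∧ ∀ u v, G.Adj u v → (D u v ↔ ¬ D v u)

/-- There is a directed walk of length `n` from `u` to `v` in the digraph `D`. -/
def DPath (D : V → V → Prop) : ℕ → V → V → Prop
  | 0, u, v => u = v
  | n + 1, u, v => ∃ w, D u w ∧ DPath D n w v

/-- Directed distance from `u` to `v` (`⊤` if `v` is not reachable from `u`). -/
noncomputable def ddist (D : V → V → Prop) (u v : V) : ℕ∞ :=
  sInf {n : ℕ∞ | ∃ m : ℕ, n = (m : ℕ∞) ∧ DPath D m u v}

/-- Diameter of a digraph: supremum of directed distances over all ordered pairs. -/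
noncomputable def odiam (D : V → V → Prop) : ℕ∞ :=
  ⨆ u : V, ⨆ v : V, ddist D u v

/-- A strong orientation of `G`: an orientation in which every vertex is reachable
from every other vertex by a directed path. -/
def IsStrongOrientation (G : SimpleGraph V) (D : V → V → Prop) : Prop :=
  IsOrientation G D ∧ ∀ u v, ∃ m : ℕ, DPath D m u v

/-- The orientation number of `G`: minimum diameter over all strong orientations. -/
noncomputable def orientNum (G : SimpleGraph V) : ℕ∞ :=
  sInf {d : ℕ∞ | ∃ D : V → V → Prop, IsStrongOrientation G D ∧ d = odiam D}

/-- The vertex-multiplication `G(s)`: vertex `v` is replaced by `s v` copies, and copies of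
`v_i`, `v_j` are adjacent iff `v_i v_j` is an edge of `G` (whence `i ≠ j`). -/
def vertexMult (G : SimpleGraph V) (s : V → ℕ) : SimpleGraph (Σ v : V, Fin (s v)) where
  Adj x y := G.Adj x.1 y.1
  symm := ⟨fun _ _ h => G.symm.symm _ _ h⟩
  loopless := ⟨fun x h => G.loopless.irrefl x.1 h⟩

/-- Eccentricity of a vertex. -/
noncomputable def ecc (G : SimpleGraph V) (v : V) : ℕ∞ :=
  ⨆ u : V, G.edist v u

namespace DPath

theorem trans {D : V → V → Prop} {m n : ℕ} {u v w : V} (h : DPath D m u v) (h' : DPath D n v w) :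
    DPath D (m + n) u w := by
  induction m generalizing u with
  | zero => obtain rfl : u = v := h; simpa using h'
  | succ m ih =>
    obtain ⟨x, hx, hxv⟩ := h
    rw [Nat.add_right_comm]
    exact ⟨x, hx, ih hxv⟩

end DPath

/-- `v` is reachable from `u` by a directed walk of length at most `n`. -/
def ReachWithin (D : V → V → Prop) (n : ℕ) (u v : V) : Prop :=
  ∃ m ≤ n, DPath D m u v

namespace ReachWithin

variable {D : V → V → Prop} {m n : ℕ} {u v w : V}

theorem refl (u : V) : ReachWithin D 0 u u := ⟨0, le_rfl, rfl⟩

theorem of_arc (h : D u v) : ReachWithin D 1 u v := ⟨1, le_rfl, v, h, rfl⟩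

theorem trans (h : ReachWithin D m u v) (h' : ReachWithin D n v w) :
    ReachWithin D (m + n) u w := by
  obtain ⟨k, hk, p⟩ := h
  obtain ⟨l, hl, q⟩ := h'
  exact ⟨k + l, by omega, p.trans q⟩

theorem mono (h : ReachWithin D m u v) (hmn : m ≤ n) : ReachWithin D n u v := by
  obtain ⟨k, hk, p⟩ := h
  exact ⟨k, hk.trans hmn, p⟩

theorem ddist_le (h : ReachWithin D n u v) : ddist D u v ≤ n := by
  obtain ⟨k, hk, p⟩ := h
  have hle : ddist D u v ≤ k := sInf_le ⟨k, rfl, p⟩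
  exact hle.trans (by exact_mod_cast hk)

end ReachWithin

section DirectedFourCycle

variable {D : V → V → Prop} {h : Fin 4 → V}

theorem reachWithin_of_fourCycle (hcyc : ∀ i, D (h i) (h (i + 1))) (i j : Fin 4) :
    ReachWithin D (j - i).val (h i) (h j) := by
  have key : ∀ (n : ℕ) (hn : n < 4), ReachWithin D n (h i) (h (i + ⟨n, hn⟩)) := by
    intro n
    induction n with
    | zero => intro _; simpa using ReachWithin.refl (h i)
    | succ n ih =>
      intro hn
      have hstep := (ih (by omega)).trans (.of_arc (hcyc _))
      have hidx : i + ⟨n, by omega⟩ + 1 = i + ⟨n + 1, hn⟩ := by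
        rw [add_assoc]
        congr 1
        apply Fin.ext
        simp [Fin.val_add]
        omega
      rwa [hidx] at hstep
  simpa using key (j - i).val (j - i).isLt

/-- If every vertex is suitably close to and from a directed 4-cycle, then any two vertices are
joined by a directed walk of length at most six. -/
theorem reachWithin_six_of_fourCycle (hcyc : ∀ i, D (h i) (h (i + 1)))
    (hout : ∀ p, (∃ i, D p (h i)) ∨ ReachWithin D 2 p (h 1) ∨
      (ReachWithin D 3 p (h 0) ∧ ReachWithin D 3 p (h 2)))
    (hin : ∀ q, (∃ i, D (h i) q) ∨ ReachWithin D 2 (h 1) q ∨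
      (ReachWithin D 3 (h 0) q ∧ ReachWithin D 3 (h 2) q)) (p q : V) :
    ReachWithin D 6 p q := by
  have via : ∀ {m n : ℕ} (i j : Fin 4), ReachWithin D m p (h i) → ReachWithin D n (h j) q →
      m + (j - i).val + n ≤ 6 → ReachWithin D 6 p q := fun i j h₁ h₂ hle =>
    ((h₁.trans (reachWithin_of_fourCycle hcyc i j)).trans h₂).mono hle
  obtain ⟨i, hp⟩ | hp | ⟨hp₀, hp₂⟩ := hout p <;> obtain ⟨j, hq⟩ | hq | ⟨hq₀, hq₂⟩ := hin q
  · exact via i j (.of_arc hp) (.of_arc hq) (by omega)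
  · exact via i 1 (.of_arc hp) hq (by omega)
  · obtain hi | hi : (0 - i).val ≤ 1 ∨ (2 - i).val ≤ 1 := by clear hp via; revert i; decide
    · exact via i 0 (.of_arc hp) hq₀ (by omega)
    · exact via i 2 (.of_arc hp) hq₂ (by omega)
  · exact via 1 j hp (.of_arc hq) (by omega)
  · exact via 1 1 hp hq (by decide)
  · exact via 1 2 hp hq₂ (by decide)
  · obtain hj | hj : (j - 0).val ≤ 1 ∨ (j - 2).val ≤ 1 := by clear hq via; revert j; decide
    · exact via 0 j hp₀ (.of_arc hq) (by omega)
    · exact via 2 j hp₂ (.of_arc hq) (by omega)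
  · exact via 0 1 hp₀ hq (by decide)
  · exact via 0 0 hp₀ hq₀ (by decide)

end DirectedFourCycle

section CentralEdge

variable {T : SimpleGraph V} {a b : V}

theorem eq_of_adj_of_dist_lt_of_dist_lt (hT : T.IsTree) (hab : T.Adj a b) {u w : V}
    (huw : T.Adj u w) (hu : T.dist a u < T.dist b u) (hw : T.dist b w < T.dist a w) :
    u = a ∧ w = b := by
  classical
  obtain ⟨q₁, hq₁⟩ := hT.connected.exists_walk_length_eq_dist a u
  obtain ⟨q₂, hq₂⟩ := hT.connected.exists_walk_length_eq_dist w b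
  have hbr := isBridge_iff_forall_walk_mem_edges.1
    (isAcyclic_iff_forall_adj_isBridge.1 hT.isAcyclic hab) (q₁.append (.cons huw q₂))
  rw [Walk.edges_append, Walk.edges_cons, List.mem_append, List.mem_cons] at hbr
  obtain h | h | h := hbr
  · have hb := q₁.snd_mem_support_of_mem_edges h
    have := dist_le (q₁.dropUntil b hb)
    have := q₁.length_dropUntil_le_length hb
    omega
  · obtain ⟨rfl, rfl⟩ | ⟨rfl, rfl⟩ := Sym2.eq_iff.1 h
    · exact ⟨rfl, rfl⟩
    · simp at hu
  · have ha := q₂.fst_mem_support_of_mem_edges h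
    have := dist_le (q₂.takeUntil a ha)
    rw [dist_comm (u := w) (v := a)] at this
    have := q₂.length_takeUntil_le_length ha
    rw [dist_comm (u := w) (v := b)] at hq₂
    omega

theorem dist_lt_or_dist_lt (hT : T.IsTree) (hab : T.Adj a b) (v : V) :
    T.dist a v < T.dist b v ∨ T.dist b v < T.dist a v := by
  have := hT.dist_ne_of_adj v hab
  rw [dist_comm (u := v) (v := a), dist_comm (u := v) (v := b)] at this
  omega

theorem dist_add_one_add_dist_le_length (hT : T.IsTree) (hab : T.Adj a b) {v w : V}
    (p : T.Walk v w) (hv : T.dist a v < T.dist b v) (hw : T.dist b w < T.dist a w) :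
    T.dist a v + 1 + T.dist b w ≤ p.length := by
  induction p with
  | nil => omega
  | @cons v x w h p ih =>
    rw [Walk.length_cons]
    obtain hx | hx := dist_lt_or_dist_lt hT hab x
    · have := ih hx hw
      have := hT.connected.dist_triangle (u := a) (v := x) (w := v)
      have := dist_eq_one_iff_adj.2 h.symm
      omega
    · obtain ⟨rfl, rfl⟩ := eq_of_adj_of_dist_lt_of_dist_lt hT hab h hv hx
      have := dist_le p
      simp
      omega

theorem dist_le_two_of_dist_lt (hT : T.IsTree) (hdiam : ∀ u v, T.dist u v ≤ 5) (hab : T.Adj a b)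
    {w : V} (hbw : T.dist b w = 2) (haw : T.dist a w = 3) {v : V}
    (hv : T.dist a v < T.dist b v) : T.dist a v ≤ 2 := by
  obtain ⟨p, hp⟩ := hT.connected.exists_walk_length_eq_dist v w
  have := dist_add_one_add_dist_le_length hT hab p hv (by omega)
  have := hdiam v w
  omega

theorem exists_central_edge (hT : T.IsTree) [Finite V] (hdiam : T.ediam = 5) :
    ∃ a b, T.Adj a b ∧ (∀ v, T.dist a v < T.dist b v → T.dist a v ≤ 2) ∧
      ∀ v, T.dist b v < T.dist a v → T.dist b v ≤ 2 := by
  have hconn := hT.connected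
  have := hconn.nonempty
  have hle : ∀ u v, T.dist u v ≤ 5 := fun u v => by
    have h := T.edist_le_ediam (u := u) (v := v)
    rw [hdiam, ← (hconn u v).coe_dist_eq_edist] at h
    exact_mod_cast h
  obtain ⟨u, v, huv⟩ := T.exists_edist_eq_ediam_of_finite
  rw [hdiam, ← (hconn u v).coe_dist_eq_edist] at huv
  have huv : T.dist u v = 5 := by exact_mod_cast huv
  obtain ⟨p, hp⟩ := hconn.exists_walk_length_eq_dist u v
  have hadj : T.Adj (p.getVert 2) (p.getVert 3) := p.adj_getVert_succ (by omega)
  have h₁ := dist_le (p.take 2)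
  have h₂ := dist_le (p.drop 3)
  rw [Walk.take_length] at h₁
  rw [Walk.drop_length] at h₂
  generalize p.getVert 2 = a at *
  generalize p.getVert 3 = b at *
  have hab := dist_eq_one_iff_adj.2 hadj
  have t₁ := hconn.dist_triangle (u := u) (v := a) (w := v)
  have t₂ := hconn.dist_triangle (u := a) (v := b) (w := v)
  have t₃ := hconn.dist_triangle (u := u) (v := b) (w := v)
  have t₄ := hconn.dist_triangle (u := u) (v := a) (w := b)
  have e₁ := T.dist_comm (u := u) (v := a)
  have e₂ := T.dist_comm (u := u) (v := b)
  exact ⟨a, b, hadj, fun x => dist_le_two_of_dist_lt hT hle hadj (w := v) (by omega) (by omega),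
    fun x => dist_le_two_of_dist_lt hT hle hadj.symm (w := u) (by omega) (by omega)⟩

/-- A labelling of the vertices around a central edge `ab`: `a` and `b` have labels `0` and `1`,
the other neighbours of `a` have label `2` or `3`, those of `b` have label `4`, and the vertices
below those of label `2` and `4` have labels `5` and `6`. -/
structure IsCentralLabelling (T : SimpleGraph V) (a b : V) (κ : V → ℕ) : Prop where
  adj : T.Adj a b
  ne_of_adj : ∀ u v, T.Adj u v → κ u ≠ κ v
  left : κ a = 0
  right : κ b = 1
  cases : ∀ v, v = a ∨ v = b ∨ (κ v = 2 ∧ T.Adj a v ∧ ∃ y, κ y = 5 ∧ T.Adj v y) ∨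
    (κ v = 3 ∧ T.Adj a v) ∨ (κ v = 4 ∧ T.Adj b v) ∨
    (κ v = 5 ∧ ∃ x, κ x = 2 ∧ T.Adj a x ∧ T.Adj x v) ∨
    (κ v = 6 ∧ ∃ x, κ x = 4 ∧ T.Adj b x ∧ T.Adj x v)

open Classical in
/-- The labelling used for a tree of diameter five with central edge `ab`. -/
noncomputable def centralLabel (T : SimpleGraph V) (a b v : V) : ℕ :=
  if T.dist a v < T.dist b v then
    if T.dist a v = 0 then 0
    else if T.dist a v = 1 then
      if ∃ y, T.Adj v y ∧ T.dist a y = 2 ∧ T.dist a y < T.dist b y then 2 else 3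
    else 5
  else if T.dist b v = 0 then 1 else if T.dist b v = 1 then 4 else 6

theorem exists_adj_adj_of_dist_eq_two (hT : T.Connected) {u v : V} (h : T.dist u v = 2) :
    ∃ x, T.Adj u x ∧ T.Adj x v := by
  obtain ⟨p, hp⟩ := hT.exists_walk_length_eq_dist u v
  refine ⟨p.getVert 1, ?_, ?_⟩
  · simpa using p.adj_getVert_succ (i := 0) (by omega)
  · have := p.adj_getVert_succ (i := 1) (by omega)
    rwa [p.getVert_of_length_le (i := 1 + 1) (by omega)] at this

theorem isCentralLabelling_centralLabel (hT : T.IsTree) (hab : T.Adj a b)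
    (ha : ∀ v, T.dist a v < T.dist b v → T.dist a v ≤ 2)
    (hb : ∀ v, T.dist b v < T.dist a v → T.dist b v ≤ 2) :
    IsCentralLabelling T a b (centralLabel T a b) := by
  have hconn := hT.connected
  have hba₁ := dist_eq_one_iff_adj.2 hab.symm
  refine ⟨hab, ?_, by simp [centralLabel, hba₁], by simp [centralLabel], ?_⟩
  · intro u v huv
    have := hT.dist_ne_of_adj a huv
    have := hT.dist_ne_of_adj b huv
    have := ha u
    have := ha v
    have := hb u
    have := hb v
    have := dist_lt_or_dist_lt hT hab u
    have := dist_lt_or_dist_lt hT hab v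
    unfold centralLabel
    split_ifs <;> omega
  · intro v
    have tri : ∀ r x y, T.Adj x y → T.dist r y ≤ T.dist r x + 1 := fun r x y h => by
      have := hconn.dist_triangle (u := r) (v := x) (w := y)
      rwa [dist_eq_one_iff_adj.2 h] at this
    obtain hv | hv := dist_lt_or_dist_lt hT hab v
    · have hv₂ := ha v hv
      obtain h | h | h : T.dist a v = 0 ∨ T.dist a v = 1 ∨ T.dist a v = 2 := by omega
      · exact .inl (hconn.dist_eq_zero_iff.1 h).symm
      · have hav := dist_eq_one_iff_adj.1 h
        by_cases hy : ∃ y, T.Adj v y ∧ T.dist a y = 2 ∧ T.dist a y < T.dist b y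
        · refine .inr (.inr (.inl ⟨?_, hav, ?_⟩))
          · unfold centralLabel
            rw [if_pos hv, if_neg (by omega), if_pos h, if_pos hy]
          · obtain ⟨y, hvy, hy, hlt⟩ := hy
            refine ⟨y, ?_, hvy⟩
            unfold centralLabel
            rw [if_pos hlt, if_neg (by omega), if_neg (by omega)]
        · refine .inr (.inr (.inr (.inl ⟨?_, hav⟩)))
          unfold centralLabel
          rw [if_pos hv, if_neg (by omega), if_pos h, if_neg hy]
      · refine .inr (.inr (.inr (.inr (.inr (.inl ⟨?_, ?_⟩)))))
        · unfold centralLabel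
          rw [if_pos hv, if_neg (by omega), if_neg (by omega)]
        · obtain ⟨x, hax, hxv⟩ := exists_adj_adj_of_dist_eq_two hconn h
          have hx := dist_eq_one_iff_adj.2 hax
          have := tri b x v hxv
          refine ⟨x, ?_, hax, hxv⟩
          unfold centralLabel
          rw [if_pos (by omega), if_neg (by omega), if_pos hx, if_pos ⟨v, hxv, h, hv⟩]
    · have hv₂ := hb v hv
      obtain h | h | h : T.dist b v = 0 ∨ T.dist b v = 1 ∨ T.dist b v = 2 := by omega
      · exact .inr (.inl (hconn.dist_eq_zero_iff.1 h).symm)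
      · refine .inr (.inr (.inr (.inr (.inl ⟨?_, dist_eq_one_iff_adj.1 h⟩))))
        unfold centralLabel
        rw [if_neg (by omega), if_neg (by omega), if_pos h]
      · refine .inr (.inr (.inr (.inr (.inr (.inr ⟨?_, ?_⟩)))))
        · unfold centralLabel
          rw [if_neg (by omega), if_neg (by omega), if_neg (by omega)]
        · obtain ⟨x, hbx, hxv⟩ := exists_adj_adj_of_dist_eq_two hconn h
          have hx := dist_eq_one_iff_adj.2 hbx
          have := tri a x v hxv
          refine ⟨x, ?_, hbx, hxv⟩
          unfold centralLabel
          rw [if_neg (by omega), if_neg (by omega), if_pos hx]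

end CentralEdge

section Orientation

variable {T : SimpleGraph V} {a b : V} {κ : V → ℕ} {s : V → ℕ}

/-- Whether the arc between a copy of a vertex of label `k` and a copy of a vertex of larger
label `l` leaves the former; the Booleans tell whether these copies are the zeroth ones. -/
def downArc : ℕ → ℕ → Bool → Bool → Bool
  | 0, 1, c, d => c == d
  | 0, 2, _, d => !d
  | 0, 3, c, d => c != d
  | 1, 4, c, d => c != d
  | 2, 5, c, _ => !c
  | 4, 6, c, _ => !c
  | _, _, _, _ => false

/-- The direction of the arc between two copies with given labels. -/
def arcDir (k l : ℕ) (c d : Bool) : Bool :=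
  if k < l then downArc k l c d else !downArc l k d c

/-- Whether a vertex of the vertex-multiplication is the zeroth copy. -/
def isZeroth (p : Σ v : V, Fin (s v)) : Bool := decide (p.2.val = 0)

/-- The orientation of the vertex-multiplication determined by a labelling. -/
def labelOrientation (T : SimpleGraph V) (κ : V → ℕ) (s : V → ℕ) (p q : Σ v : V, Fin (s v)) :
    Prop :=
  T.Adj p.1 q.1 ∧ arcDir (κ p.1) (κ q.1) (isZeroth p) (isZeroth q) = true

theorem isOrientation_labelOrientation (hκ : ∀ u v, T.Adj u v → κ u ≠ κ v) :
    IsOrientation (vertexMult T s) (labelOrientation T κ s) := by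
  refine ⟨fun p q h => h.1, fun p q (h : T.Adj p.1 q.1) => ?_⟩
  have hne := hκ _ _ h
  simp only [labelOrientation, h, h.symm, true_and, arcDir]
  obtain hlt | hlt := lt_or_gt_of_ne hne
  · simp [hlt, hlt.not_gt]
  · simp [hlt, hlt.not_gt]

/-- The zeroth or the first copy of a vertex. -/
def binaryCopy (hs : ∀ v, 2 ≤ s v) (v : V) (c : Bool) : Σ v : V, Fin (s v) :=
  ⟨v, ⟨(!c).toNat, lt_of_lt_of_le (by cases c <;> decide) (hs v)⟩⟩

theorem isZeroth_binaryCopy (hs : ∀ v, 2 ≤ s v) (v : V) (c : Bool) :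
    isZeroth (binaryCopy hs v c) = c := by
  cases c <;> rfl

theorem labelOrientation_of {p q : Σ v : V, Fin (s v)} {k l : ℕ} {c d : Bool}
    (h : T.Adj p.1 q.1) (hk : κ p.1 = k) (hl : κ q.1 = l) (hc : isZeroth p = c)
    (hd : isZeroth q = d) (harc : arcDir k l c d = true) : labelOrientation T κ s p q := by
  subst hk hl hc hd
  exact ⟨h, harc⟩

theorem labelOrientation_binaryCopy (hs : ∀ v, 2 ≤ s v) {u v : V} {k l : ℕ} {c d : Bool}
    (h : T.Adj u v) (hk : κ u = k) (hl : κ v = l) (harc : arcDir k l c d = true) :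
    labelOrientation T κ s (binaryCopy hs u c) (binaryCopy hs v d) :=
  labelOrientation_of h hk hl (isZeroth_binaryCopy hs u c) (isZeroth_binaryCopy hs v d) harc

theorem reachWithin_six_labelOrientation (hκ : IsCentralLabelling T a b κ) (hs : ∀ v, 2 ≤ s v)
    (p q : Σ v : V, Fin (s v)) : ReachWithin (labelOrientation T κ s) 6 p q := by
  have hab := hκ.adj
  have ha := hκ.left
  have hb := hκ.right
  let C := binaryCopy hs
  have zC : ∀ v c, isZeroth (C v c) = c := isZeroth_binaryCopy hs
  refine reachWithin_six_of_fourCycle (h := ![C a true, C b true, C a false, C b false])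
    ?_ ?_ ?_ p q
  · intro i
    fin_cases i
    · exact labelOrientation_binaryCopy hs hab ha hb rfl
    · exact labelOrientation_binaryCopy hs hab.symm hb ha rfl
    · exact labelOrientation_binaryCopy hs hab ha hb rfl
    · exact labelOrientation_binaryCopy hs hab.symm hb ha rfl
  · rintro p
    obtain h | h | ⟨h, hadj, y, hy, hxy⟩ | ⟨h, hadj⟩ | ⟨h, hadj⟩ | ⟨h, x, hx, hax, hxy⟩ |
      ⟨h, x, hx, hbx, hxy⟩ := hκ.cases p.1 <;> cases hc : isZeroth p
    · exact .inl ⟨3, labelOrientation_of (h ▸ hab) (h ▸ ha) hb hc (zC _ _) rfl⟩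
    · exact .inl ⟨1, labelOrientation_of (h ▸ hab) (h ▸ ha) hb hc (zC _ _) rfl⟩
    · exact .inl ⟨0, labelOrientation_of (h ▸ hab.symm) (h ▸ hb) ha hc (zC _ _) rfl⟩
    · exact .inl ⟨2, labelOrientation_of (h ▸ hab.symm) (h ▸ hb) ha hc (zC _ _) rfl⟩
    · have r : ReachWithin (labelOrientation T κ s) 2 p (C p.1 true) :=
        (ReachWithin.of_arc (labelOrientation_of (q := C y true) hxy h hy hc (zC _ _) rfl)).trans
          (.of_arc (labelOrientation_binaryCopy hs hxy.symm hy h rfl))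
      exact .inr (.inr
        ⟨r.trans (.of_arc (labelOrientation_binaryCopy hs hadj.symm h ha rfl)),
        r.trans (.of_arc (labelOrientation_binaryCopy hs hadj.symm h ha rfl))⟩)
    · exact .inl ⟨0, labelOrientation_of hadj.symm h ha hc (zC _ _) rfl⟩
    · exact .inl ⟨2, labelOrientation_of hadj.symm h ha hc (zC _ _) rfl⟩
    · exact .inl ⟨0, labelOrientation_of hadj.symm h ha hc (zC _ _) rfl⟩
    · exact .inl ⟨3, labelOrientation_of hadj.symm h hb hc (zC _ _) rfl⟩
    · exact .inl ⟨1, labelOrientation_of hadj.symm h hb hc (zC _ _) rfl⟩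
    iterate 2
      have r : ReachWithin (labelOrientation T κ s) 1 p (C x true) :=
        .of_arc (labelOrientation_of hxy.symm h hx hc (zC _ _) rfl)
      exact .inr (.inr
        ⟨(r.trans (.of_arc (labelOrientation_binaryCopy hs hax.symm hx ha rfl))).mono
          (by decide),
        (r.trans (.of_arc (labelOrientation_binaryCopy hs hax.symm hx ha rfl))).mono
          (by decide)⟩)
    iterate 2
      exact .inr (.inl ((ReachWithin.of_arc
        (labelOrientation_of (q := C x true) hxy.symm h hx hc (zC _ _) rfl)).trans
          (.of_arc (labelOrientation_binaryCopy hs hbx.symm hx hb rfl))))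
  · rintro p
    obtain h | h | ⟨h, hadj, y, hy, hxy⟩ | ⟨h, hadj⟩ | ⟨h, hadj⟩ | ⟨h, x, hx, hax, hxy⟩ |
      ⟨h, x, hx, hbx, hxy⟩ := hκ.cases p.1 <;> cases hc : isZeroth p
    · exact .inl ⟨1, labelOrientation_of (h ▸ hab.symm) hb (h ▸ ha) (zC _ _) hc rfl⟩
    · exact .inl ⟨3, labelOrientation_of (h ▸ hab.symm) hb (h ▸ ha) (zC _ _) hc rfl⟩
    · exact .inl ⟨2, labelOrientation_of (h ▸ hab) ha (h ▸ hb) (zC _ _) hc rfl⟩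
    · exact .inl ⟨0, labelOrientation_of (h ▸ hab) ha (h ▸ hb) (zC _ _) hc rfl⟩
    · exact .inl ⟨0, labelOrientation_of hadj ha h (zC _ _) hc rfl⟩
    · have r : ReachWithin (labelOrientation T κ s) 2 (C p.1 false) p :=
        (ReachWithin.of_arc
          (labelOrientation_binaryCopy hs (d := true) hxy h hy rfl)).trans
          (.of_arc (labelOrientation_of hxy.symm hy h (zC _ _) hc rfl))
      exact .inr (.inr
        ⟨(ReachWithin.of_arc (labelOrientation_binaryCopy hs hadj ha h rfl)).trans r,
        (ReachWithin.of_arc (labelOrientation_binaryCopy hs hadj ha h rfl)).trans r⟩)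
    · exact .inl ⟨0, labelOrientation_of hadj ha h (zC _ _) hc rfl⟩
    · exact .inl ⟨2, labelOrientation_of hadj ha h (zC _ _) hc rfl⟩
    · exact .inl ⟨1, labelOrientation_of hadj hb h (zC _ _) hc rfl⟩
    · exact .inl ⟨3, labelOrientation_of hadj hb h (zC _ _) hc rfl⟩
    iterate 2
      have r : ReachWithin (labelOrientation T κ s) 1 (C x false) p :=
        .of_arc (labelOrientation_of hxy hx h (zC _ _) hc rfl)
      exact .inr (.inr
        ⟨((ReachWithin.of_arc (labelOrientation_binaryCopy hs hax ha hx rfl)).trans r).mono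
          (by decide),
        ((ReachWithin.of_arc (labelOrientation_binaryCopy hs hax ha hx rfl)).trans r).mono
          (by decide)⟩)
    iterate 2
      exact .inr (.inl ((ReachWithin.of_arc
        (labelOrientation_binaryCopy hs (d := false) hbx hb hx rfl)).trans
          (.of_arc (labelOrientation_of hxy hx h (zC _ _) hc rfl))))

end Orientation

theorem orientNum_le_of_reachWithin {G : SimpleGraph V} {D : V → V → Prop} {n : ℕ}
    (hD : IsOrientation G D) (h : ∀ u v, ReachWithin D n u v) : orientNum G ≤ n := by
  have hstrong : IsStrongOrientation G D := ⟨hD, fun u v => by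
    obtain ⟨m, -, p⟩ := h u v
    exact ⟨m, p⟩⟩
  have hle : orientNum G ≤ odiam D := sInf_le ⟨D, hstrong, rfl⟩
  exact hle.trans (iSup₂_le fun u v => (h u v).ddist_le)

theorem edist_le_of_dPath {T : SimpleGraph V} {s : V → ℕ}
    {D : (Σ v : V, Fin (s v)) → (Σ v : V, Fin (s v)) → Prop}
    (hD : IsOrientation (vertexMult T s) D) {m : ℕ} {p q : Σ v : V, Fin (s v)}
    (h : DPath D m p q) : T.edist p.1 q.1 ≤ m := by
  induction m generalizing p with
  | zero => obtain rfl : p = q := h; simp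
  | succ m ih =>
    obtain ⟨r, hpr, hrq⟩ := h
    have hadj : T.Adj p.1 r.1 := hD.1 _ _ hpr
    refine (T.edist_triangle (v := r.1)).trans ?_
    rw [edist_eq_one_iff_adj.2 hadj, add_comm, Nat.cast_succ]
    gcongr
    exact ih hrq

theorem ediam_le_orientNum_vertexMult {T : SimpleGraph V} {s : V → ℕ} (hs : ∀ v, s v ≠ 0) :
    T.ediam ≤ orientNum (vertexMult T s) := by
  refine le_sInf ?_
  rintro _ ⟨D, hD, rfl⟩
  refine ediam_le_of_edist_le fun u v => ?_
  have key : T.edist u v ≤ ddist D ⟨u, 0, Nat.pos_of_ne_zero (hs u)⟩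
      ⟨v, 0, Nat.pos_of_ne_zero (hs v)⟩ := by
    refine le_sInf ?_
    rintro _ ⟨m, rfl, h⟩
    exact edist_le_of_dPath hD.1 h
  exact key.trans (le_iSup₂ (f := fun p q => ddist D p q) _ _)

theorem stmt3 [Fintype V] (T : SimpleGraph V) (hT : T.IsTree) (hdiam : T.ediam = 5)
    (s : V → ℕ) (hs : ∀ v, 2 ≤ s v) :
    5 ≤ orientNum (vertexMult T s) ∧ orientNum (vertexMult T s) ≤ 6 := by
  refine ⟨hdiam ▸ ediam_le_orientNum_vertexMult fun v => by have := hs v; omega, ?_⟩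
  obtain ⟨a, b, hab, ha, hb⟩ := exists_central_edge hT hdiam
  have hκ := isCentralLabelling_centralLabel hT hab ha hb
  exact orientNum_le_of_reachWithin (isOrientation_labelOrientation hκ.ne_of_adj)
    (reachWithin_six_labelOrientation hκ hs)
end

section
/- Let T be a tree of diameter 5 with vertex set {v_1, ..., v_n}, where v_1 and v_2 are its two central vertices (the two adjacent vertices of eccentricity 3). For k = 1, 2, let NL_k be the set of neighbours of v_k other than v_{3-k} that are not leaves of T, and let m_k = min{ s_v : v ∈ NL_k }. Let s_1, ..., s_n be integers with s_i ≥ 2 for all i, s_1 = s_2 = 2, and suppose 2 ≤ m_1 ≤ 3 or 2 ≤ m_2 ≤ 3. Then d̄(T(s_1, ..., s_n)) = 5 (i.e., T(s_1, ..., s_n) ∈ C_0) if and only if |NL_k| = 1 for some k ∈ {1, 2}. -/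
open SimpleGraph

variable {V : Type*}

/-! ### Levels in a tree of diameter 5 -/

/-- `h` arranges the vertices of `T` in six levels: `v₁` alone on level `2`, `v₂` alone on level
`3`, the remaining neighbours of `v₁` and `v₂` on levels `1` and `4`, and the leaves below them on
levels `0` and `5`. -/
structure CentralLevel (T : SimpleGraph V) (v₁ v₂ : V) (h : V → ℕ) : Prop where
  adj : ∀ x y, T.Adj x y → h y = h x + 1 ∨ h x = h y + 1
  le_five : ∀ x, h x ≤ 5
  eq_two : ∀ x, h x = 2 ↔ x = v₁
  eq_three : ∀ x, h x = 3 ↔ x = v₂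
  adj_center : T.Adj v₁ v₂
  adj_left : ∀ x, h x = 1 → T.Adj v₁ x
  adj_right : ∀ x, h x = 4 → T.Adj v₂ x
  parent_zero : ∀ x, h x = 0 → ∃ u, T.Adj x u ∧ ∀ u', T.Adj x u' → u' = u
  parent_five : ∀ x, h x = 5 → ∃ u, T.Adj x u ∧ ∀ u', T.Adj x u' → u' = u
  exists_zero : ∃ x, h x = 0
  exists_five : ∃ x, h x = 5

lemma CentralLevel.swap {T : SimpleGraph V} {v₁ v₂ : V} {h : V → ℕ}
    (hL : CentralLevel T v₁ v₂ h) : CentralLevel T v₂ v₁ (fun x => 5 - h x) where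
  adj x y hxy := by
    have := hL.adj x y hxy
    have := hL.le_five x
    have := hL.le_five y
    omega
  le_five x := by omega
  eq_two x := by
    rw [← hL.eq_three]
    omega
  eq_three x := by
    rw [← hL.eq_two]
    omega
  adj_center := hL.adj_center.symm
  adj_left x hx := hL.adj_right x (by omega)
  adj_right x hx := hL.adj_left x (by omega)
  parent_zero x hx := hL.parent_five x (by have := hL.le_five x; omega)
  parent_five x hx := hL.parent_zero x (by have := hL.le_five x; omega)
  exists_zero := hL.exists_five.imp fun x hx => by omega
  exists_five := hL.exists_zero.imp fun x hx => by omega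

/-- In a tree, a vertex has at most one neighbour closer to a given root. -/
lemma SimpleGraph.IsTree.closer_neighbor_unique {T : SimpleGraph V} (hT : T.IsTree) {r x z z' : V}
    (hz : T.Adj z x) (hz' : T.Adj z' x) (hd : T.dist r x = T.dist r z + 1)
    (hd' : T.dist r x = T.dist r z' + 1) : z = z' := by
  obtain ⟨p, hp⟩ := hT.connected.exists_walk_length_eq_dist r z
  obtain ⟨q, hq⟩ := hT.connected.exists_walk_length_eq_dist r z'
  have h₁ : (p.concat hz).IsPath := Walk.isPath_of_length_eq_dist _ (by simp [hp, hd])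
  have h₂ : (q.concat hz').IsPath := Walk.isPath_of_length_eq_dist _ (by simp [hq, hd'])
  have h₃ := congrArg Subtype.val ((hT.isAcyclic.subsingleton_path r x).elim ⟨_, h₁⟩ ⟨_, h₂⟩)
  simpa using congrArg Walk.penultimate h₃

/-- A vertex other than the root has a neighbour closer to the root. -/
lemma SimpleGraph.IsTree.exists_closer_neighbor {T : SimpleGraph V} (hT : T.IsTree) {r x : V}
    (hx : T.dist r x ≠ 0) : ∃ z, T.Adj z x ∧ T.dist r x = T.dist r z + 1 := by
  obtain ⟨p, hp⟩ := hT.connected.exists_walk_length_eq_dist r x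
  have hnil : ¬ p.Nil := fun hn => hx (by rw [← hp, Walk.length_eq_zero_iff.mpr hn])
  have hadj := Walk.adj_penultimate hnil
  refine ⟨_, hadj, ?_⟩
  have h₁ : T.dist r p.penultimate ≤ p.dropLast.length := dist_le _
  have h₂ : p.dropLast.length + 1 = p.length := by
    rw [← Walk.length_concat _ hadj, Walk.concat_dropLast]
  rcases hT.dist_eq_dist_add_one_of_adj r hadj with h | h <;> omega

lemma dist_le_of_ecc_eq {T : SimpleGraph V} (hT : T.IsTree) {v : V} {n : ℕ}
    (he : ecc T v = n) (x : V) : T.dist v x ≤ n := by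
  have h₁ : T.edist v x ≤ ecc T v := le_iSup (fun u => T.edist v u) x
  rw [he, ← (hT.connected v x).coe_dist_eq_edist] at h₁
  exact_mod_cast h₁

lemma exists_dist_eq_of_ecc_eq [Finite V] {T : SimpleGraph V} (hT : T.IsTree) {v : V} {n : ℕ}
    (he : ecc T v = n) : ∃ x, T.dist v x = n := by
  have : Nonempty V := ⟨v⟩
  obtain ⟨x, hx⟩ := exists_eq_ciSup_of_finite (f := fun u => T.edist v u)
  have hx' : T.edist v x = n := hx.trans he
  rw [← (hT.connected v x).coe_dist_eq_edist] at hx'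
  exact ⟨x, by exact_mod_cast hx'⟩

lemma exists_centralLevel [Finite V] {T : SimpleGraph V} (hT : T.IsTree) {v₁ v₂ : V}
    (hadj : T.Adj v₁ v₂) (hecc₁ : ecc T v₁ = 3) (hecc₂ : ecc T v₂ = 3) :
    ∃ h, CentralLevel T v₁ v₂ h := by
  have le₁ := dist_le_of_ecc_eq hT (n := 3) (by exact_mod_cast hecc₁)
  have le₂ := dist_le_of_ecc_eq hT (n := 3) (by exact_mod_cast hecc₂)
  obtain ⟨w₁, hw₁⟩ := exists_dist_eq_of_ecc_eq hT (n := 3) (by exact_mod_cast hecc₁)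
  obtain ⟨w₂, hw₂⟩ := exists_dist_eq_of_ecc_eq hT (n := 3) (by exact_mod_cast hecc₂)
  have sides : ∀ x, T.dist v₁ x = T.dist v₂ x + 1 ∨ T.dist v₂ x = T.dist v₁ x + 1 := fun x => by
    simpa only [dist_comm] using hT.dist_eq_dist_add_one_of_adj x hadj
  have step₁ : ∀ x y, T.Adj x y →
      T.dist v₁ x = T.dist v₁ y + 1 ∨ T.dist v₁ y = T.dist v₁ x + 1 :=
    fun x y hxy => hT.dist_eq_dist_add_one_of_adj v₁ hxy
  have step₂ : ∀ x y, T.Adj x y →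
      T.dist v₂ x = T.dist v₂ y + 1 ∨ T.dist v₂ y = T.dist v₂ x + 1 :=
    fun x y hxy => hT.dist_eq_dist_add_one_of_adj v₂ hxy
  have zero₁ : ∀ x, T.dist v₁ x = 0 ↔ x = v₁ := fun x => by
    rw [hT.connected.dist_eq_zero_iff, eq_comm]
  have zero₂ : ∀ x, T.dist v₂ x = 0 ↔ x = v₂ := fun x => by
    rw [hT.connected.dist_eq_zero_iff, eq_comm]
  have cross : ∀ x y, T.Adj x y → T.dist v₂ x = T.dist v₁ x + 1 →
      T.dist v₁ y = T.dist v₂ y + 1 → y = v₂ := by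
    intro x y hxy hx hy
    by_contra hne
    obtain ⟨z, hz, hzd⟩ := hT.exists_closer_neighbor (mt (zero₂ y).mp hne)
    have h₁ := step₁ _ _ hxy
    have h₂ := step₂ _ _ hxy
    have h₃ := step₁ _ _ hz
    have h₄ := sides z
    have : z = x := hT.closer_neighbor_unique (r := v₁) hz hxy (by omega) (by omega)
    subst this
    omega
  have hv₁ : T.dist v₂ v₁ = 1 := dist_eq_one_iff_adj.mpr hadj.symm
  have hv₂ : T.dist v₁ v₂ = 1 := dist_eq_one_iff_adj.mpr hadj
  have hadj_level : ∀ x y, T.Adj x y → T.dist v₂ x = T.dist v₁ x + 1 →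
      T.dist v₁ y = T.dist v₂ y + 1 → x = v₁ ∧ y = v₂ := by
    intro x y hxy hx hy
    obtain rfl := cross x y hxy hx hy
    refine ⟨(zero₁ x).mp ?_, rfl⟩
    have h₁ := step₂ _ _ hxy
    have h₂ := (zero₂ y).mpr rfl
    omega
  have self₁ := (zero₁ v₁).mpr rfl
  have self₂ := (zero₂ v₂).mpr rfl
  refine ⟨fun x => if T.dist v₁ x < T.dist v₂ x then 2 - T.dist v₁ x else 3 + T.dist v₂ x,
    ?_, ?_, ?_, ?_, hadj, ?_, ?_, ?_, ?_, ?_, ?_⟩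
  · intro x y hxy
    have h₁ := step₁ _ _ hxy
    have h₂ := step₂ _ _ hxy
    have h₃ := sides x
    have h₄ := sides y
    have h₅ := le₁ x
    have h₆ := le₁ y
    have h₇ := le₂ x
    have h₈ := le₂ y
    rcases h₃ with h₃ | h₃ <;> rcases h₄ with h₄ | h₄
    · split_ifs <;> omega
    · obtain ⟨rfl, rfl⟩ := hadj_level y x hxy.symm h₄ h₃
      split_ifs <;> omega
    · obtain ⟨rfl, rfl⟩ := hadj_level x y hxy h₃ h₄
      split_ifs <;> omega
    · split_ifs <;> omega
  · intro x
    have := sides x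
    have := le₁ x
    split_ifs <;> omega
  · intro x
    have := sides x
    rw [← zero₁ x]
    have := le₂ x
    split_ifs <;> omega
  · intro x
    have := sides x
    rw [← zero₂ x]
    split_ifs <;> omega
  · intro x hx
    rw [← dist_eq_one_iff_adj]
    split_ifs at hx <;> omega
  · intro x hx
    rw [← dist_eq_one_iff_adj]
    split_ifs at hx <;> omega
  · intro x hx
    have hx2 : T.dist v₁ x = 2 ∧ T.dist v₂ x = 3 := by
      have := sides x
      have := le₂ x
      split_ifs at hx <;> omega
    obtain ⟨u, hu, hd⟩ := hT.exists_closer_neighbor (r := v₁) (x := x) (by omega)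
    refine ⟨u, hu.symm, fun u' hu' => hT.closer_neighbor_unique (r := v₁) hu'.symm hu ?_ hd⟩
    have := step₁ _ _ hu'
    have := step₂ _ _ hu'
    rcases sides u' with hs | hs
    · obtain ⟨rfl, rfl⟩ := hadj_level _ _ hu' (by omega) hs
      omega
    · have := le₂ u'
      omega
  · intro x hx
    have hx2 : T.dist v₂ x = 2 ∧ T.dist v₁ x = 3 := by
      have := sides x
      split_ifs at hx <;> omega
    obtain ⟨u, hu, hd⟩ := hT.exists_closer_neighbor (r := v₂) (x := x) (by omega)
    refine ⟨u, hu.symm, fun u' hu' => hT.closer_neighbor_unique (r := v₂) hu'.symm hu ?_ hd⟩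
    have := step₂ _ _ hu'
    have := step₁ _ _ hu'
    rcases sides u' with hs | hs
    · have := le₁ u'
      omega
    · obtain ⟨rfl, rfl⟩ := hadj_level _ _ hu'.symm hs (by omega)
      omega
  · refine ⟨w₂, ?_⟩
    have := sides w₂
    have := le₁ w₂
    split_ifs <;> omega
  · refine ⟨w₁, ?_⟩
    have := sides w₁
    have := le₂ w₁
    split_ifs <;> omega

/-- The non-leaf neighbours of `v₁` are the level-`1` vertices with a neighbour on level `0`. -/
lemma CentralLevel.nonleaf_left_eq [Finite V] {T : SimpleGraph V} {v₁ v₂ : V} {h : V → ℕ}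
    (hL : CentralLevel T v₁ v₂ h) :
    {u : V | T.Adj v₁ u ∧ u ≠ v₂ ∧ (T.neighborSet u).ncard ≠ 1} =
      {u | h u = 1 ∧ ∃ w, h w = 0 ∧ T.Adj w u} := by
  have h₂ := (hL.eq_two v₁).mpr rfl
  ext u
  constructor
  · rintro ⟨hu, hne, hc⟩
    have hu1 : h u = 1 := by
      have := hL.adj _ _ hu
      have := mt (hL.eq_three u).mp hne
      omega
    refine ⟨hu1, ?_⟩
    by_contra! hno
    refine hc (Set.ncard_eq_one.mpr ⟨v₁, Set.eq_singleton_iff_unique_mem.mpr ⟨hu.symm, ?_⟩⟩)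
    intro w hw
    have := hL.adj _ _ hw
    have h0 : h w ≠ 0 := fun h0 => hno w h0 (SimpleGraph.Adj.symm hw)
    exact (hL.eq_two w).mp (by omega)
  · rintro ⟨hu, w, hw, hwu⟩
    have hadj := hL.adj_left u hu
    refine ⟨hadj, fun he => by
      have := (hL.eq_three u).mpr he
      omega, fun hc => ?_⟩
    obtain ⟨z, hz⟩ := Set.ncard_eq_one.mp hc
    have e₁ : v₁ = z := by
      have : v₁ ∈ T.neighborSet u := hadj.symm
      simpa [hz] using this
    have e₂ : w = z := by
      have : w ∈ T.neighborSet u := hwu.symm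
      simpa [hz] using this
    rw [e₂, ← e₁] at hw
    omega

/-! ### Directed paths across the levels -/

section Paths

variable {X : Type*} {D : X → X → Prop} {H : X → ℕ}

lemma DPath.append : ∀ {m n : ℕ} {x y z : X}, DPath D m x y → DPath D n y z →
    DPath D (m + n) x z
  | 0, n, x, y, z, h₁, h₂ => by
    obtain rfl : x = y := h₁
    simpa using h₂
  | m + 1, n, x, y, z, ⟨w, hw, h₁⟩, h₂ => by
    rw [Nat.add_right_comm]
    exact ⟨w, hw, h₁.append h₂⟩

lemma DPath.level_le (hH : ∀ x y, D x y → H y = H x + 1 ∨ H x = H y + 1) :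
    ∀ {m : ℕ} {x y : X}, DPath D m x y → H y ≤ H x + m
  | 0, x, y, h => by
    obtain rfl : x = y := h
    omega
  | m + 1, x, y, ⟨w, hw, h⟩ => by
    have := h.level_le hH
    have := hH _ _ hw
    omega

lemma DPath.ascend (hH : ∀ x y, D x y → H y = H x + 1 ∨ H x = H y + 1) {m : ℕ} {x y : X}
    (hm : m ≤ 5) (hp : DPath D m x y) (hxy : H y = H x + 4) :
    ∃ c d e, D x c ∧ D c d ∧ D d e ∧ D e y ∧ H c = H x + 1 ∧ H d = H x + 2 := by
  interval_cases m
  · obtain rfl := hp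
    omega
  · obtain ⟨c, h₁, rfl⟩ := hp
    have := hH _ _ h₁
    omega
  · obtain ⟨c, h₁, d, h₂, rfl⟩ := hp
    have := hH _ _ h₁
    have := hH _ _ h₂
    omega
  · obtain ⟨c, h₁, d, h₂, e, h₃, rfl⟩ := hp
    have := hH _ _ h₁
    have := hH _ _ h₂
    have := hH _ _ h₃
    omega
  · obtain ⟨c, h₁, d, h₂, e, h₃, f, h₄, rfl⟩ := hp
    have := hH _ _ h₁
    have := hH _ _ h₂
    have := hH _ _ h₃
    have := hH _ _ h₄
    exact ⟨c, d, e, h₁, h₂, h₃, h₄, by omega, by omega⟩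
  · obtain ⟨c, h₁, d, h₂, e, h₃, f, h₄, g, h₅, rfl⟩ := hp
    have := hH _ _ h₁
    have := hH _ _ h₂
    have := hH _ _ h₃
    have := hH _ _ h₄
    have := hH _ _ h₅
    omega

lemma DPath.descend (hH : ∀ x y, D x y → H y = H x + 1 ∨ H x = H y + 1) {m : ℕ} {x y : X}
    (hx5 : ∀ z, H z ≤ 5) (hm : m ≤ 5) (hp : DPath D m x y) (hxy : H x = H y + 4) :
    ∃ e d c, D x e ∧ D e d ∧ D d c ∧ D c y ∧ H d = H y + 2 ∧ H c = H y + 1 := by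
  have hH' : ∀ x y, D x y → 5 - H y = 5 - H x + 1 ∨ 5 - H x = 5 - H y + 1 := fun x y hD => by
    have := hH _ _ hD
    have := hx5 x
    have := hx5 y
    omega
  have := hx5 x
  obtain ⟨e, d, c, h₁, h₂, h₃, h₄, -, -⟩ :=
    DPath.ascend (H := fun z => 5 - H z) hH' hm hp (by omega)
  have := hH _ _ h₁
  have := hH _ _ h₂
  have := hH _ _ h₃
  have := hH _ _ h₄
  exact ⟨e, d, c, h₁, h₂, h₃, h₄, by omega, by omega⟩

lemma odiam_le_iff {k : ℕ} :
    odiam D ≤ k ↔ ∀ x y, ∃ m ≤ k, DPath D m x y := by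
  simp only [odiam, iSup_le_iff]
  refine forall_congr' fun x => forall_congr' fun y => ⟨fun h => ?_, ?_⟩
  · have hne : {n : ℕ∞ | ∃ m : ℕ, n = (m : ℕ∞) ∧ DPath D m x y}.Nonempty := by
      by_contra hemp
      rw [Set.not_nonempty_iff_eq_empty] at hemp
      rw [ddist, hemp, sInf_empty] at h
      simp at h
    obtain ⟨m, hm, hp⟩ := csInf_mem hne
    refine ⟨m, ?_, hp⟩
    rw [ddist, hm] at h
    exact_mod_cast h
  · rintro ⟨m, hm, hp⟩
    have h₁ : ddist D x y ≤ m := sInf_le ⟨m, rfl, hp⟩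
    exact h₁.trans (by exact_mod_cast hm)

end Paths

/-! ### Lower bound -/

section Lower

variable {T : SimpleGraph V} {v₁ v₂ : V} {h : V → ℕ} {s : V → ℕ}
  {D : (Σ v : V, Fin (s v)) → (Σ v : V, Fin (s v)) → Prop}

lemma CentralLevel.dir_level (hL : CentralLevel T v₁ v₂ h)
    (hD : IsOrientation (vertexMult T s) D) (x y) (hxy : D x y) :
    h y.1 = h x.1 + 1 ∨ h x.1 = h y.1 + 1 :=
  hL.adj _ _ (hD.1 _ _ hxy)

lemma CentralLevel.five_le_odiam (hL : CentralLevel T v₁ v₂ h) (hs : ∀ v, 2 ≤ s v)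
    (hD : IsOrientation (vertexMult T s) D) : 5 ≤ odiam D := by
  obtain ⟨w, hw⟩ := hL.exists_zero
  obtain ⟨w', hw'⟩ := hL.exists_five
  by_contra! hlt
  have hle : odiam D ≤ (4 : ℕ) := ENat.lt_add_one_iff (by simp) |>.mp (by exact_mod_cast hlt)
  obtain ⟨m, hm, hp⟩ := odiam_le_iff.mp hle
    ⟨w, ⟨0, by have := hs w; omega⟩⟩ ⟨w', ⟨0, by have := hs w'; omega⟩⟩
  have := DPath.level_le (H := fun z : Σ v : V, Fin (s v) => h z.1) (hL.dir_level hD) hp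
  simp only at this
  omega

lemma exists_two_copies {v : V} (hv : s v = 2) : ∃ a b : Σ v : V, Fin (s v),
    a ≠ b ∧ a.1 = v ∧ b.1 = v ∧ ∀ z : Σ v : V, Fin (s v), z.1 = v → z = a ∨ z = b := by
  refine ⟨⟨v, ⟨0, by omega⟩⟩, ⟨v, ⟨1, by omega⟩⟩, by simp, rfl, rfl, ?_⟩
  rintro ⟨z, i⟩ (rfl : z = v)
  have hi := i.2
  simp only [Sigma.mk.injEq, heq_eq_eq, true_and, Fin.ext_iff]
  omega

lemma eq_of_ne_of_ne {v : V} (hv : s v = 2) {c d e : Σ v : V, Fin (s v)} (hc : c.1 = v)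
    (hd : d.1 = v) (he : e.1 = v) (hdc : d ≠ c) (hec : e ≠ c) : d = e := by
  obtain ⟨a, b, -, -, -, hab⟩ := exists_two_copies hv
  rcases hab c hc with rfl | rfl <;> rcases hab d hd with rfl | rfl <;>
    rcases hab e he with rfl | rfl <;> simp_all

lemma exists_other_copy {v : V} (hv : s v = 2) {c : Σ v : V, Fin (s v)} (hc : c.1 = v) :
    ∃ c' : Σ v : V, Fin (s v), c'.1 = v ∧ c' ≠ c := by
  obtain ⟨a, b, hne, ha, hb, hab⟩ := exists_two_copies hv
  rcases hab c hc with rfl | rfl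
  exacts [⟨b, hb, hne.symm⟩, ⟨a, ha, hne⟩]

lemma IsOrientation.asymm {X : Type*} {G : SimpleGraph X} {D : X → X → Prop}
    (hD : IsOrientation G D) {x y : X} (hxy : D x y) : ¬ D y x :=
  (hD.2 x y (hD.1 x y hxy)).mp hxy

/-- An orientation of diameter at most `5` of a vertex-multiplication of a tree with central level
function `h`, in which both central vertices are doubled and each has at least two non-leaf
neighbours on its own side. -/
structure ShortOrientation (T : SimpleGraph V) (v₁ v₂ : V) (h : V → ℕ) (s : V → ℕ)
    (D : (Σ v : V, Fin (s v)) → (Σ v : V, Fin (s v)) → Prop) : Prop where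
  level : CentralLevel T v₁ v₂ h
  mult : ∀ v, 2 ≤ s v
  mult_left : s v₁ = 2
  mult_right : s v₂ = 2
  orient : IsOrientation (vertexMult T s) D
  short : ∀ x y, ∃ m ≤ 5, DPath D m x y
  left : ∃ u u' w w', u ≠ u' ∧ h w = 0 ∧ h w' = 0 ∧ T.Adj w u ∧ T.Adj w' u'
  right : ∃ u u' w w', u ≠ u' ∧ h w = 5 ∧ h w' = 5 ∧ T.Adj w u ∧ T.Adj w' u'

namespace ShortOrientation

lemma swap (S : ShortOrientation T v₁ v₂ h s D) :
    ShortOrientation T v₂ v₁ (fun x => 5 - h x) s D where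
  level := S.level.swap
  mult := S.mult
  mult_left := S.mult_right
  mult_right := S.mult_left
  orient := S.orient
  short := S.short
  left := by
    obtain ⟨u, u', w, w', hne, hw, hw', ha, ha'⟩ := S.right
    exact ⟨u, u', w, w', hne, by omega, by omega, ha, ha'⟩
  right := by
    obtain ⟨u, u', w, w', hne, hw, hw', ha, ha'⟩ := S.left
    exact ⟨u, u', w, w', hne, by omega, by omega, ha, ha'⟩

lemma up (S : ShortOrientation T v₁ v₂ h s D) {p y : Σ v : V, Fin (s v)} (hp : h p.1 = 1)
    (hy : h y.1 = 5) : ∃ c d q, D p c ∧ D c d ∧ D d q ∧ D q y ∧ c.1 = v₁ ∧ d.1 = v₂ := by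
  obtain ⟨m, hm, hpath⟩ := S.short p y
  obtain ⟨c, d, q, h₁, h₂, h₃, h₄, hc, hd⟩ := DPath.ascend
    (H := fun z : Σ v : V, Fin (s v) => h z.1) (S.level.dir_level S.orient) hm hpath (by omega)
  exact ⟨c, d, q, h₁, h₂, h₃, h₄, (S.level.eq_two _).mp (by omega),
    (S.level.eq_three _).mp (by omega)⟩

lemma down (S : ShortOrientation T v₁ v₂ h s D) {p y : Σ v : V, Fin (s v)} (hp : h p.1 = 1)
    (hy : h y.1 = 5) : ∃ q d c, D y q ∧ D q d ∧ D d c ∧ D c p ∧ d.1 = v₂ ∧ c.1 = v₁ := by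
  obtain ⟨m, hm, hpath⟩ := S.short y p
  obtain ⟨q, d, c, h₁, h₂, h₃, h₄, hd, hc⟩ := DPath.descend
    (H := fun z : Σ v : V, Fin (s v) => h z.1) (S.level.dir_level S.orient)
    (fun z => S.level.le_five _) hm hpath (by omega)
  exact ⟨q, d, c, h₁, h₂, h₃, h₄, (S.level.eq_three _).mp (by omega),
    (S.level.eq_two _).mp (by omega)⟩

/-- Leaves below different neighbours of `v₁` are joined through a copy of `v₁`. -/
lemma across (S : ShortOrientation T v₁ v₂ h s D) {x x' : Σ v : V, Fin (s v)} {u u' : V}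
    (hx : h x.1 = 0) (hx' : h x'.1 = 0) (hu : T.Adj x.1 u) (hu' : T.Adj x'.1 u') (hne : u ≠ u') :
    ∃ p c q, D x p ∧ D p c ∧ D c q ∧ D q x' ∧ c.1 = v₁ ∧ h p.1 = 1 ∧ h q.1 = 1 := by
  have lev := S.level.dir_level S.orient
  have par : ∀ {z z' : Σ v : V, Fin (s v)} {t : V}, h z.1 = 0 → T.Adj z.1 t → T.Adj z.1 z'.1 →
      z'.1 = t := by
    intro z z' t hz ht hz'
    obtain ⟨r, -, hr⟩ := S.level.parent_zero _ hz
    rw [hr _ ht, hr _ hz']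
  have adj := S.orient.1
  obtain ⟨m, hm, hp⟩ := S.short x x'
  interval_cases m
  · obtain rfl := hp
    obtain ⟨r, -, hr⟩ := S.level.parent_zero _ hx
    exact absurd ((hr _ hu).trans (hr _ hu').symm) hne
  · obtain ⟨c, h₁, rfl⟩ := hp
    have := lev _ _ h₁
    omega
  · obtain ⟨c, h₁, d, h₂, rfl⟩ := hp
    exact absurd ((par hx hu (adj _ _ h₁)).symm.trans (par hx' hu' (adj _ _ h₂).symm)) hne
  · obtain ⟨c, h₁, d, h₂, e, h₃, rfl⟩ := hp
    have := lev _ _ h₁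
    have := lev _ _ h₂
    have := lev _ _ h₃
    omega
  · obtain ⟨p, h₁, c, h₂, q, h₃, f, h₄, rfl⟩ := hp
    have e₁ := lev _ _ h₁
    have e₂ := lev _ _ h₂
    have e₃ := lev _ _ h₃
    have e₄ := lev _ _ h₄
    have hc : h c.1 ≠ 0 := fun hc0 => by
      refine hne ?_
      rw [← par hx hu (adj _ _ h₁), ← par hx' hu' (adj _ _ h₄).symm]
      exact par hc0 (adj _ _ h₃) (adj _ _ h₂).symm
    exact ⟨p, c, q, h₁, h₂, h₃, h₄, (S.level.eq_two _).mp (by omega), by omega, by omega⟩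
  · obtain ⟨c, h₁, d, h₂, e, h₃, f, h₄, g, h₅, rfl⟩ := hp
    have := lev _ _ h₁
    have := lev _ _ h₂
    have := lev _ _ h₃
    have := lev _ _ h₄
    have := lev _ _ h₅
    omega

lemma exists_copy_five (S : ShortOrientation T v₁ v₂ h s D) :
    ∃ y : Σ v : V, Fin (s v), h y.1 = 5 := by
  obtain ⟨w, hw⟩ := S.level.exists_five
  exact ⟨⟨w, ⟨0, by have := S.mult w; omega⟩⟩, hw⟩

lemma exists_out (S : ShortOrientation T v₁ v₂ h s D) {p : Σ v : V, Fin (s v)}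
    (hp : h p.1 = 1) : ∃ c, c.1 = v₁ ∧ D p c := by
  obtain ⟨y, hy⟩ := S.exists_copy_five
  obtain ⟨c, -, -, hpc, -, -, -, hc, -⟩ := S.up hp hy
  exact ⟨c, hc, hpc⟩

lemma exists_in (S : ShortOrientation T v₁ v₂ h s D) {p : Σ v : V, Fin (s v)}
    (hp : h p.1 = 1) : ∃ c, c.1 = v₁ ∧ D c p := by
  obtain ⟨y, hy⟩ := S.exists_copy_five
  obtain ⟨-, -, c, -, -, -, hcp, -, hc⟩ := S.down hp hy
  exact ⟨c, hc, hcp⟩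

/-- A level-`1` vertex has exactly one out-neighbour among the two copies of `v₁`. -/
lemma out_unique (S : ShortOrientation T v₁ v₂ h s D) {p c c' : Σ v : V, Fin (s v)}
    (hp : h p.1 = 1) (hc : c.1 = v₁) (hc' : c'.1 = v₁) (hpc : D p c) (hpc' : D p c') :
    c' = c := by
  by_contra hne
  obtain ⟨e, he, hep⟩ := S.exists_in hp
  have h₁ : e ≠ c := by rintro rfl; exact S.orient.asymm hpc hep
  have h₂ := eq_of_ne_of_ne S.mult_left hc he hc' h₁ hne
  subst h₂
  exact S.orient.asymm hpc' hep

lemma in_unique (S : ShortOrientation T v₁ v₂ h s D) {p c c' : Σ v : V, Fin (s v)}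
    (hp : h p.1 = 1) (hc : c.1 = v₁) (hc' : c'.1 = v₁) (hcp : D c p) (hcp' : D c' p) :
    c' = c := by
  by_contra hne
  obtain ⟨e, he, hep⟩ := S.exists_out hp
  have h₁ : e ≠ c := by rintro rfl; exact S.orient.asymm hcp hep
  have h₂ := eq_of_ne_of_ne S.mult_left hc he hc' h₁ hne
  subst h₂
  exact S.orient.asymm hcp' hep

/-- Each copy of `v₁` is the out-neighbour of some level-`1` vertex. -/
lemma exists_pred (S : ShortOrientation T v₁ v₂ h s D) {c : Σ v : V, Fin (s v)}
    (hc : c.1 = v₁) : ∃ p, h p.1 = 1 ∧ D p c := by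
  by_contra! hno
  obtain ⟨u, u', w, w', hne, hw, hw', ha, ha'⟩ := S.left
  obtain ⟨p, c₁, q, -, hpc, hcq, -, hc₁, hp, hq⟩ := S.across
    (x := ⟨w, ⟨0, by have := S.mult w; omega⟩⟩) (x' := ⟨w', ⟨0, by have := S.mult w'; omega⟩⟩)
    hw hw' ha ha' hne
  obtain ⟨c₂, hc₂, hqc⟩ := S.exists_out hq
  have h₁ : c₁ ≠ c := by rintro rfl; exact hno p hp hpc
  have h₂ : c₂ ≠ c := by rintro rfl; exact hno q hq hqc
  have h₃ := eq_of_ne_of_ne S.mult_left hc hc₁ hc₂ h₁ h₂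
  subst h₃
  exact S.orient.asymm hcq hqc

/-- Each copy of `v₁` is the in-neighbour of some level-`1` vertex. -/
lemma exists_succ (S : ShortOrientation T v₁ v₂ h s D) {c : Σ v : V, Fin (s v)}
    (hc : c.1 = v₁) : ∃ p, h p.1 = 1 ∧ D c p := by
  obtain ⟨c', hc', hne⟩ := exists_other_copy S.mult_left hc
  obtain ⟨p, hp, hpc'⟩ := S.exists_pred hc'
  obtain ⟨e, he, hep⟩ := S.exists_in hp
  have h₁ : e ≠ c' := by rintro rfl; exact S.orient.asymm hpc' hep
  have h₂ := eq_of_ne_of_ne S.mult_left hc' he hc h₁ hne.symm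
  exact ⟨p, hp, h₂ ▸ hep⟩

lemma exists_center_out (S : ShortOrientation T v₁ v₂ h s D) {c : Σ v : V, Fin (s v)}
    (hc : c.1 = v₁) : ∃ d, d.1 = v₂ ∧ D c d := by
  obtain ⟨p, hp, hpc⟩ := S.exists_pred hc
  obtain ⟨y, hy⟩ := S.exists_copy_five
  obtain ⟨c₁, d, -, hpc₁, hcd, -, -, hc₁, hd⟩ := S.up hp hy
  obtain rfl := S.out_unique hp hc hc₁ hpc hpc₁
  exact ⟨d, hd, hcd⟩

lemma exists_center_in (S : ShortOrientation T v₁ v₂ h s D) {c : Σ v : V, Fin (s v)}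
    (hc : c.1 = v₁) : ∃ d, d.1 = v₂ ∧ D d c := by
  obtain ⟨p, hp, hcp⟩ := S.exists_succ hc
  obtain ⟨y, hy⟩ := S.exists_copy_five
  obtain ⟨-, d, c₁, -, -, hdc, hcp₁, hd, hc₁⟩ := S.down hp hy
  obtain rfl := S.in_unique hp hc hc₁ hcp hcp₁
  exact ⟨d, hd, hdc⟩

/-- Each copy of `v₁` lies two steps after every leaf below `v₁`. -/
lemma exists_from_leaf (S : ShortOrientation T v₁ v₂ h s D) {x c : Σ v : V, Fin (s v)}
    (hx : h x.1 = 0) (hc : c.1 = v₁) : ∃ p, D x p ∧ D p c := by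
  obtain ⟨d, hd, hcd⟩ := S.exists_center_out hc
  obtain ⟨q, hq, hdq⟩ := S.swap.exists_succ hd
  obtain ⟨p, c₁, d₁, hxp, hpc, hcd₁, hdq₁, hc₁, hd₁⟩ := S.swap.down hq (by omega : 5 - h x.1 = 5)
  obtain rfl := S.swap.in_unique hq hd hd₁ hdq hdq₁
  obtain ⟨e, he, hde⟩ := S.swap.exists_center_out hd
  refine ⟨p, hxp, ?_⟩
  have h₁ : c₁ ≠ e := by rintro rfl; exact S.orient.asymm hcd₁ hde
  have h₂ : c ≠ e := by rintro rfl; exact S.orient.asymm hcd hde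
  exact eq_of_ne_of_ne S.mult_left he hc₁ hc h₁ h₂ ▸ hpc

/-- Each copy of `v₁` lies two steps before every leaf below `v₁`. -/
lemma exists_to_leaf (S : ShortOrientation T v₁ v₂ h s D) {x c : Σ v : V, Fin (s v)}
    (hx : h x.1 = 0) (hc : c.1 = v₁) : ∃ p, D c p ∧ D p x := by
  obtain ⟨d, hd, hdc⟩ := S.exists_center_in hc
  obtain ⟨q, hq, hqd⟩ := S.swap.exists_pred hd
  obtain ⟨d₁, c₁, p, hqd₁, hdc₁, hcp, hpx, hd₁, hc₁⟩ := S.swap.up hq (by omega : 5 - h x.1 = 5)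
  obtain rfl := S.swap.out_unique hq hd hd₁ hqd hqd₁
  obtain ⟨e, he, hed⟩ := S.swap.exists_center_in hd
  refine ⟨p, ?_, hpx⟩
  have h₁ : c₁ ≠ e := by rintro rfl; exact S.orient.asymm hdc₁ hed
  have h₂ : c ≠ e := by rintro rfl; exact S.orient.asymm hdc hed
  exact eq_of_ne_of_ne S.mult_left he hc₁ hc h₁ h₂ ▸ hcp

/-- Non-leaf neighbours of `v₁` have multiplicity at least four. -/
lemma four_le_mult (S : ShortOrientation T v₁ v₂ h s D) {u w : V} (hw : h w = 0)
    (hu : T.Adj w u) : 4 ≤ s u := by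
  obtain ⟨a, b, hab, ha, hb, -⟩ := exists_two_copies S.mult_left
  let x : Σ v : V, Fin (s v) := ⟨w, ⟨0, by have := S.mult w; omega⟩⟩
  have hx : h x.1 = 0 := hw
  have lev := S.level.dir_level S.orient
  obtain ⟨p₁, h₁, k₁⟩ := S.exists_from_leaf hx ha
  obtain ⟨p₂, h₂, k₂⟩ := S.exists_from_leaf hx hb
  obtain ⟨p₃, k₃, h₃⟩ := S.exists_to_leaf hx ha
  obtain ⟨p₄, k₄, h₄⟩ := S.exists_to_leaf hx hb
  have par : ∀ p : Σ v : V, Fin (s v), T.Adj w p.1 → p.1 = u := by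
    intro p hp
    obtain ⟨r, -, hr⟩ := S.level.parent_zero _ hw
    rw [hr _ hp, hr _ hu]
  have ne₁₂ : p₁ ≠ p₂ := by
    rintro rfl
    have := lev _ _ h₁
    exact hab (S.out_unique (by omega) hb ha k₂ k₁)
  have ne₃₄ : p₃ ≠ p₄ := by
    rintro rfl
    have := lev _ _ h₃
    exact hab (S.in_unique (by omega) hb ha k₄ k₃)
  have out_ne_in : ∀ {p q}, D x p → D q x → p ≠ q := by
    rintro p q hp hq rfl
    exact S.orient.asymm hp hq
  have ne₁₃ := out_ne_in h₁ h₃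
  have ne₁₄ := out_ne_in h₁ h₄
  have ne₂₃ := out_ne_in h₂ h₃
  have ne₂₄ := out_ne_in h₂ h₄
  obtain ⟨_, i₁⟩ := p₁
  obtain ⟨_, i₂⟩ := p₂
  obtain ⟨_, i₃⟩ := p₃
  obtain ⟨_, i₄⟩ := p₄
  obtain rfl := par _ (S.orient.1 _ _ h₁)
  obtain rfl := par _ (S.orient.1 _ _ h₂)
  obtain rfl := par _ (S.orient.1 _ _ h₃).symm
  obtain rfl := par _ (S.orient.1 _ _ h₄).symm
  simp only [ne_eq, Sigma.mk.injEq, heq_eq_eq, true_and] at ne₁₂ ne₃₄ ne₁₃ ne₁₄ ne₂₃ ne₂₄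
  have hcard : ({i₁, i₂, i₃, i₄} : Finset (Fin (s _))).card = 4 := by
    simp [ne₁₂, ne₃₄, ne₁₃, ne₁₄, ne₂₃, ne₂₄]
  have := Finset.card_le_univ ({i₁, i₂, i₃, i₄} : Finset (Fin (s _)))
  rwa [hcard, Fintype.card_fin] at this

end ShortOrientation

end Lower
/-! ### Upper bound -/

section Upper

variable {X : Type*} {D : X → X → Prop}

/-- `y` can be reached from `x` by a directed walk of length at most `k`. -/
def Within (D : X → X → Prop) (k : ℕ) (x y : X) : Prop :=
  ∃ m ≤ k, DPath D m x y

lemma Within.refl (k : ℕ) (x : X) : Within D k x x := ⟨0, k.zero_le, rfl⟩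

lemma Within.arc {x y : X} (h : D x y) : Within D 1 x y := ⟨1, le_rfl, y, h, rfl⟩

lemma Within.mono {j k : ℕ} {x y : X} (h : Within D j x y) (hjk : j ≤ k) : Within D k x y :=
  h.imp fun _ hm => ⟨hm.1.trans hjk, hm.2⟩

lemma Within.trans {j k : ℕ} {x y z : X} (h₁ : Within D j x y) (h₂ : Within D k y z) :
    Within D (j + k) x z := by
  obtain ⟨m, hm, hp⟩ := h₁
  obtain ⟨n, hn, hq⟩ := h₂
  exact ⟨m + n, add_le_add hm hn, hp.append hq⟩

/-- Whether the edge between copy `i` of a level-`k` vertex and copy `j` of a level-`(k + 1)`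
vertex is directed upwards in `hubOrientation`. -/
def upward : ℕ → ℕ → ℕ → Prop
  | 0, i, j => (i = 0 ↔ j = 0)
  | 1, _, j => j = 0
  | 2, i, _ => i = 0
  | 3, i, j => ¬(i = 0 ↔ j = 0)
  | _, i, _ => i ≠ 0

/-- An orientation in which all traffic from the `v₁`-side to the `v₂`-side leaves through copy `0`
of `v₁`, and all traffic back enters through copy `1`. -/
def hubOrientation (T : SimpleGraph V) (h s : V → ℕ) (x y : Σ v : V, Fin (s v)) : Prop :=
  T.Adj x.1 y.1 ∧ ((h y.1 = h x.1 + 1 ∧ upward (h x.1) x.2 y.2) ∨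
    (h x.1 = h y.1 + 1 ∧ ¬ upward (h y.1) y.2 x.2))

variable {T : SimpleGraph V} {v₁ v₂ : V} {h s : V → ℕ}

lemma CentralLevel.isOrientation_hub (hL : CentralLevel T v₁ v₂ h) :
    IsOrientation (vertexMult T s) (hubOrientation T h s) := by
  refine ⟨fun _ _ hxy => hxy.1, fun x y hxy => ?_⟩
  have hxy' : T.Adj x.1 y.1 := hxy
  simp only [hubOrientation, hxy', hxy'.symm, true_and]
  rcases hL.adj _ _ hxy' with hl | hl
  · have hne : h x.1 ≠ h y.1 + 1 := by omega
    simp [hl, hl ▸ hne]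
  · have hne : h y.1 ≠ h x.1 + 1 := by omega
    simp [hl, hl ▸ hne]

/-- Copy `0` or `1` of the vertex `v`. -/
def copy (hs : ∀ v, 2 ≤ s v) (v : V) (i : Fin 2) : Σ v : V, Fin (s v) :=
  ⟨v, ⟨i, i.2.trans_le (hs v)⟩⟩

lemma eq_copy_or (hs : ∀ v, 2 ≤ s v) {v : V} (hv : s v = 2) {z : Σ v : V, Fin (s v)}
    (hz : z.1 = v) : z = copy hs v 0 ∨ z = copy hs v 1 := by
  obtain ⟨z, i⟩ := z
  obtain rfl : z = v := hz
  have hi := i.2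
  simp only [copy, Sigma.mk.injEq, heq_eq_eq, true_and, Fin.ext_iff, Fin.val_zero, Fin.val_one]
  omega

lemma hub_up {x y : Σ v : V, Fin (s v)} (hxy : T.Adj x.1 y.1) (k : ℕ) (hx : h x.1 = k)
    (hy : h y.1 = k + 1) (hu : upward k x.2 y.2) : Within (hubOrientation T h s) 1 x y :=
  Within.arc ⟨hxy, Or.inl ⟨by omega, by rwa [hx]⟩⟩

lemma hub_down {x y : Σ v : V, Fin (s v)} (hxy : T.Adj x.1 y.1) (k : ℕ) (hx : h x.1 = k + 1)
    (hy : h y.1 = k) (hu : ¬ upward k y.2 x.2) : Within (hubOrientation T h s) 1 x y :=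
  Within.arc ⟨hxy, Or.inr ⟨by omega, by rwa [hy]⟩⟩

/-- The setting of the upper bound: both central vertices are doubled and only one neighbour of
`v₁` other than `v₂` is not a leaf. -/
structure HubSetting (T : SimpleGraph V) (v₁ v₂ : V) (h s : V → ℕ) : Prop where
  level : CentralLevel T v₁ v₂ h
  mult : ∀ v, 2 ≤ s v
  mult_left : s v₁ = 2
  mult_right : s v₂ = 2
  unique : ∀ u u' w w', h w = 0 → h w' = 0 → T.Adj w u → T.Adj w' u' → u = u'

namespace HubSetting

lemma level_left (S : HubSetting T v₁ v₂ h s) : h v₁ = 2 := (S.level.eq_two _).mpr rfl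

lemma level_right (S : HubSetting T v₁ v₂ h s) : h v₂ = 3 := (S.level.eq_three _).mpr rfl

lemma eq_left (S : HubSetting T v₁ v₂ h s) {z : Σ v : V, Fin (s v)} (hz : h z.1 = 2) :
    z = copy S.mult v₁ 0 ∨ z = copy S.mult v₁ 1 :=
  eq_copy_or S.mult S.mult_left ((S.level.eq_two _).mp hz)

lemma eq_right (S : HubSetting T v₁ v₂ h s) {z : Σ v : V, Fin (s v)} (hz : h z.1 = 3) :
    z = copy S.mult v₂ 0 ∨ z = copy S.mult v₂ 1 :=
  eq_copy_or S.mult S.mult_right ((S.level.eq_three _).mp hz)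

lemma exists_parent_zero (S : HubSetting T v₁ v₂ h s) {x : V} (hx : h x = 0) :
    ∃ u, T.Adj x u ∧ h u = 1 := by
  obtain ⟨u, hu, -⟩ := S.level.parent_zero x hx
  exact ⟨u, hu, by have := S.level.adj _ _ hu; omega⟩

lemma exists_parent_five (S : HubSetting T v₁ v₂ h s) {y : V} (hy : h y = 5) :
    ∃ u, T.Adj y u ∧ h u = 4 := by
  obtain ⟨u, hu, -⟩ := S.level.parent_five y hy
  exact ⟨u, hu, by have := S.level.adj _ _ hu; have := S.level.le_five u; omega⟩

lemma one_to_out (S : HubSetting T v₁ v₂ h s) {p : Σ v : V, Fin (s v)} (hp : h p.1 = 1) :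
    Within (hubOrientation T h s) 1 p (copy S.mult v₁ 0) :=
  hub_up (S.level.adj_left _ hp).symm 1 hp S.level_left rfl

lemma in_to_one (S : HubSetting T v₁ v₂ h s) {p : Σ v : V, Fin (s v)} (hp : h p.1 = 1) :
    Within (hubOrientation T h s) 1 (copy S.mult v₁ 1) p :=
  hub_down (S.level.adj_left _ hp) 1 S.level_left hp one_ne_zero

lemma out_to_three (S : HubSetting T v₁ v₂ h s) {d : Σ v : V, Fin (s v)} (hd : h d.1 = 3) :
    Within (hubOrientation T h s) 1 (copy S.mult v₁ 0) d :=
  hub_up ((S.level.eq_three _).mp hd ▸ S.level.adj_center) 2 S.level_left hd rfl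

lemma three_to_in (S : HubSetting T v₁ v₂ h s) {d : Σ v : V, Fin (s v)} (hd : h d.1 = 3) :
    Within (hubOrientation T h s) 1 d (copy S.mult v₁ 1) :=
  hub_down ((S.level.eq_three _).mp hd ▸ S.level.adj_center.symm) 2 hd S.level_left one_ne_zero

lemma out_to_in (S : HubSetting T v₁ v₂ h s) :
    Within (hubOrientation T h s) 2 (copy S.mult v₁ 0) (copy S.mult v₁ 1) :=
  (S.out_to_three (d := copy S.mult v₂ 0) S.level_right).trans (S.three_to_in S.level_right)

lemma in_to_out (S : HubSetting T v₁ v₂ h s) :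
    Within (hubOrientation T h s) 2 (copy S.mult v₁ 1) (copy S.mult v₁ 0) := by
  obtain ⟨w, hw⟩ := S.level.exists_zero
  obtain ⟨u, -, hu⟩ := S.exists_parent_zero hw
  exact (S.in_to_one (p := copy S.mult u 0) hu).trans (S.one_to_out hu)

lemma left_to_out (S : HubSetting T v₁ v₂ h s) {x : Σ v : V, Fin (s v)} (hx : h x.1 ≤ 2) :
    Within (hubOrientation T h s) 2 x (copy S.mult v₁ 0) := by
  obtain hx | hx | hx : h x.1 = 0 ∨ h x.1 = 1 ∨ h x.1 = 2 := by omega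
  · obtain ⟨u, hu, hu1⟩ := S.exists_parent_zero hx
    by_cases hi : (x.2 : ℕ) = 0
    · exact (hub_up (y := copy S.mult u 0) hu 0 hx hu1 (by simp [upward, copy, hi])).trans
        (S.one_to_out hu1)
    · exact (hub_up (y := copy S.mult u 1) hu 0 hx hu1 (by simp [upward, copy, hi])).trans
        (S.one_to_out hu1)
  · exact (S.one_to_out hx).mono (by norm_num)
  · obtain rfl | rfl := S.eq_left hx
    exacts [Within.refl _ _, S.in_to_out]

lemma in_to_left (S : HubSetting T v₁ v₂ h s) {x : Σ v : V, Fin (s v)} (hx : h x.1 ≤ 2) :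
    Within (hubOrientation T h s) 2 (copy S.mult v₁ 1) x := by
  obtain hx | hx | hx : h x.1 = 0 ∨ h x.1 = 1 ∨ h x.1 = 2 := by omega
  · obtain ⟨u, hu, hu1⟩ := S.exists_parent_zero hx
    by_cases hi : (x.2 : ℕ) = 0
    · exact (S.in_to_one (p := copy S.mult u 1) hu1).trans
        (hub_down hu.symm 0 hu1 hx (by simp [upward, copy, hi]))
    · exact (S.in_to_one (p := copy S.mult u 0) hu1).trans
        (hub_down hu.symm 0 hu1 hx (by simp [upward, copy, hi]))
  · exact (S.in_to_one hx).mono (by norm_num)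
  · obtain rfl | rfl := S.eq_left hx
    exacts [S.in_to_out, Within.refl _ _]

lemma three_of_four (S : HubSetting T v₁ v₂ h s) {p : Σ v : V, Fin (s v)} (hp : h p.1 = 4) :
    (Within (hubOrientation T h s) 1 (copy S.mult v₂ 1) p ∧
        Within (hubOrientation T h s) 1 p (copy S.mult v₂ 0)) ∨
      (Within (hubOrientation T h s) 1 (copy S.mult v₂ 0) p ∧
        Within (hubOrientation T h s) 1 p (copy S.mult v₂ 1)) := by
  have hadj := S.level.adj_right _ hp
  by_cases hi : (p.2 : ℕ) = 0
  · exact Or.inl ⟨hub_up hadj 3 S.level_right hp (by simp [upward, copy, hi]),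
      hub_down hadj.symm 3 hp S.level_right (by simp [upward, copy, hi])⟩
  · exact Or.inr ⟨hub_up hadj 3 S.level_right hp (by simp [upward, copy, hi]),
      hub_down hadj.symm 3 hp S.level_right (by simp [upward, copy, hi])⟩

lemma five_to_base (S : HubSetting T v₁ v₂ h s) {y : Σ v : V, Fin (s v)} (hy : h y.1 = 5) :
    Within (hubOrientation T h s) 2 y (copy S.mult v₂ 0) := by
  obtain ⟨u, hu, hu4⟩ := S.exists_parent_five hy
  exact Within.trans (y := copy S.mult u 0) (hub_down hu 4 hy hu4 (by simp [upward, copy]))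
    (hub_down (y := copy S.mult v₂ 0) (S.level.adj_right _ hu4).symm 3 hu4 S.level_right
      (by simp [upward, copy]))

lemma base_to_five (S : HubSetting T v₁ v₂ h s) {y : Σ v : V, Fin (s v)} (hy : h y.1 = 5) :
    Within (hubOrientation T h s) 2 (copy S.mult v₂ 0) y := by
  obtain ⟨u, hu, hu4⟩ := S.exists_parent_five hy
  exact Within.trans (y := copy S.mult u 1)
    (hub_up (S.level.adj_right _ hu4) 3 S.level_right hu4 (by simp [upward, copy]))
    (hub_up hu.symm 4 hu4 hy (by simp [upward, copy]))

lemma three_to_three (S : HubSetting T v₁ v₂ h s) {d e : Σ v : V, Fin (s v)} (hd : h d.1 = 3)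
    (he : h e.1 = 3) : Within (hubOrientation T h s) 2 d e := by
  obtain ⟨w, hw⟩ := S.level.exists_five
  obtain ⟨u, -, hu⟩ := S.exists_parent_five hw
  have hadj := S.level.adj_right _ hu
  obtain rfl | rfl := S.eq_right hd <;> obtain rfl | rfl := S.eq_right he
  · exact Within.refl _ _
  · exact Within.trans (y := copy S.mult u 1)
      (hub_up hadj 3 S.level_right hu (by simp [upward, copy]))
      (hub_down hadj.symm 3 hu S.level_right (by simp [upward, copy]))
  · exact Within.trans (y := copy S.mult u 0)
      (hub_up hadj 3 S.level_right hu (by simp [upward, copy]))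
      (hub_down hadj.symm 3 hu S.level_right (by simp [upward, copy]))
  · exact Within.refl _ _

lemma three_to_four (S : HubSetting T v₁ v₂ h s) {d p : Σ v : V, Fin (s v)} (hd : h d.1 = 3)
    (hp : h p.1 = 4) : Within (hubOrientation T h s) 3 d p := by
  obtain ⟨hin, -⟩ | ⟨hin, -⟩ := S.three_of_four hp <;>
    exact (S.three_to_three hd S.level_right).trans hin

lemma four_to_three (S : HubSetting T v₁ v₂ h s) {p d : Σ v : V, Fin (s v)} (hp : h p.1 = 4)
    (hd : h d.1 = 3) : Within (hubOrientation T h s) 3 p d := by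
  obtain ⟨-, hout⟩ | ⟨-, hout⟩ := S.three_of_four hp <;>
    exact hout.trans (S.three_to_three S.level_right hd)

lemma out_to_right (S : HubSetting T v₁ v₂ h s) {y : Σ v : V, Fin (s v)} (hy : 3 ≤ h y.1) :
    Within (hubOrientation T h s) 3 (copy S.mult v₁ 0) y := by
  obtain hy | hy | hy : h y.1 = 3 ∨ h y.1 = 4 ∨ h y.1 = 5 := by
    have := S.level.le_five y.1
    omega
  · exact (S.out_to_three hy).mono (by norm_num)
  · obtain ⟨hin, -⟩ | ⟨hin, -⟩ := S.three_of_four hy <;>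
      exact ((S.out_to_three S.level_right).trans hin).mono (by norm_num)
  · exact (S.out_to_three S.level_right).trans (S.base_to_five hy)

lemma right_to_in (S : HubSetting T v₁ v₂ h s) {y : Σ v : V, Fin (s v)} (hy : 3 ≤ h y.1) :
    Within (hubOrientation T h s) 3 y (copy S.mult v₁ 1) := by
  obtain hy | hy | hy : h y.1 = 3 ∨ h y.1 = 4 ∨ h y.1 = 5 := by
    have := S.level.le_five y.1
    omega
  · exact (S.three_to_in hy).mono (by norm_num)
  · obtain ⟨-, hout⟩ | ⟨-, hout⟩ := S.three_of_four hy <;>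
      exact (hout.trans (S.three_to_in S.level_right)).mono (by norm_num)
  · exact (S.five_to_base hy).trans (S.three_to_in S.level_right)

lemma right_to_right (S : HubSetting T v₁ v₂ h s) {x y : Σ v : V, Fin (s v)} (hx : 3 ≤ h x.1)
    (hy : 3 ≤ h y.1) : Within (hubOrientation T h s) 5 x y := by
  obtain hx | hx | hx : h x.1 = 3 ∨ h x.1 = 4 ∨ h x.1 = 5 := by
    have := S.level.le_five x.1
    omega
  all_goals
    obtain hy | hy | hy : h y.1 = 3 ∨ h y.1 = 4 ∨ h y.1 = 5 := by
      have := S.level.le_five y.1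
      omega
  · exact (S.three_to_three hx hy).mono (by norm_num)
  · exact (S.three_to_four hx hy).mono (by norm_num)
  · exact ((S.three_to_three hx S.level_right).trans (S.base_to_five hy)).mono (by norm_num)
  · exact (S.four_to_three hx hy).mono (by norm_num)
  · obtain ⟨-, hout⟩ | ⟨-, hout⟩ := S.three_of_four hx <;>
      exact (hout.trans (S.three_to_four S.level_right hy)).mono (by norm_num)
  · exact (S.four_to_three hx S.level_right).trans (S.base_to_five hy)
  · exact ((S.five_to_base hx).trans (S.three_to_three S.level_right hy)).mono (by norm_num)
  · exact (S.five_to_base hx).trans (S.three_to_four S.level_right hy)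
  · exact ((S.five_to_base hx).trans (S.base_to_five hy)).mono (by norm_num)

lemma zero_to_zero (S : HubSetting T v₁ v₂ h s) {x y : Σ v : V, Fin (s v)} (hx : h x.1 = 0)
    (hy : h y.1 = 0) : Within (hubOrientation T h s) 5 x y := by
  obtain ⟨u, hu, hu1⟩ := S.exists_parent_zero hx
  obtain ⟨u', hu', -⟩ := S.exists_parent_zero hy
  obtain rfl := S.unique _ _ _ _ hx hy hu hu'
  have up : ∀ z : Σ v : V, Fin (s v), h z.1 = 0 → T.Adj z.1 u → ∀ i : Fin 2,
      ((z.2 : ℕ) = 0 ↔ i = 0) → Within (hubOrientation T h s) 1 z (copy S.mult u i) :=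
    fun z hz hzu i hi => hub_up hzu 0 hz hu1 (by simpa [upward, copy] using hi)
  have down : ∀ z : Σ v : V, Fin (s v), h z.1 = 0 → T.Adj z.1 u → ∀ i : Fin 2,
      ¬ ((z.2 : ℕ) = 0 ↔ i = 0) → Within (hubOrientation T h s) 1 (copy S.mult u i) z :=
    fun z hz hzu i hi => hub_down hzu.symm 0 hu1 hz (by simpa [upward, copy] using hi)
  by_cases hix : (x.2 : ℕ) = 0 <;> by_cases hiy : (y.2 : ℕ) = 0
  · exact ((((up x hx hu 0 (by simp [hix])).trans
      (down (copy S.mult x.1 1) hx hu 0 (by simp [copy]))).trans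
      (up (copy S.mult x.1 1) hx hu 1 (by simp [copy]))).trans
      (down y hy hu' 1 (by simp [hiy]))).mono (by norm_num)
  · exact ((up x hx hu 0 (by simp [hix])).trans
      (down y hy hu' 0 (by simp [hiy]))).mono (by norm_num)
  · exact ((up x hx hu 1 (by simp [hix])).trans
      (down y hy hu' 1 (by simp [hiy]))).mono (by norm_num)
  · exact ((((up x hx hu 1 (by simp [hix])).trans
      (down (copy S.mult x.1 0) hx hu 1 (by simp [copy]))).trans
      (up (copy S.mult x.1 0) hx hu 0 (by simp [copy]))).trans
      (down y hy hu' 0 (by simp [hiy]))).mono (by norm_num)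

lemma left_to_left (S : HubSetting T v₁ v₂ h s) {x y : Σ v : V, Fin (s v)} (hx : h x.1 ≤ 2)
    (hy : h y.1 ≤ 2) : Within (hubOrientation T h s) 5 x y := by
  have through : Within (hubOrientation T h s) 1 x (copy S.mult v₁ 0) →
      Within (hubOrientation T h s) 5 x y :=
    fun hout => (hout.trans S.out_to_in).trans (S.in_to_left hy)
  obtain hx0 | hx1 | hx2 : h x.1 = 0 ∨ h x.1 = 1 ∨ h x.1 = 2 := by omega
  · obtain hy0 | hy1 | hy2 : h y.1 = 0 ∨ h y.1 = 1 ∨ h y.1 = 2 := by omega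
    · exact S.zero_to_zero hx0 hy0
    · exact ((S.left_to_out hx).trans S.out_to_in).trans (S.in_to_one hy1)
    · obtain rfl | rfl := S.eq_left hy2
      · exact (S.left_to_out hx).mono (by norm_num)
      · exact ((S.left_to_out hx).trans S.out_to_in).mono (by norm_num)
  · exact through (S.one_to_out hx1)
  · obtain rfl | rfl := S.eq_left hx2
    · exact through (Within.refl _ _)
    · exact (S.in_to_left hy).mono (by norm_num)

lemma within_five (S : HubSetting T v₁ v₂ h s) (x y : Σ v : V, Fin (s v)) :
    Within (hubOrientation T h s) 5 x y := by
  rcases le_or_gt (h x.1) 2 with hx | hx <;> rcases le_or_gt (h y.1) 2 with hy | hy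
  · exact S.left_to_left hx hy
  · exact (S.left_to_out hx).trans (S.out_to_right hy)
  · exact (S.right_to_in hx).trans (S.in_to_left hy)
  · exact S.right_to_right hx hy

lemma orientNum_eq (S : HubSetting T v₁ v₂ h s) : orientNum (vertexMult T s) = 5 := by
  refine le_antisymm ?_ ?_
  · have hstrong : IsStrongOrientation (vertexMult T s) (hubOrientation T h s) :=
      ⟨S.level.isOrientation_hub, fun x y => (S.within_five x y).imp fun _ hm => hm.2⟩
    have hle : orientNum (vertexMult T s) ≤ odiam (hubOrientation T h s) :=
      sInf_le ⟨_, hstrong, rfl⟩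
    exact hle.trans (odiam_le_iff (k := 5).mpr S.within_five)
  · refine le_sInf ?_
    rintro _ ⟨D, hD, rfl⟩
    exact S.level.five_le_odiam S.mult hD.1

end HubSetting

end Upper

/-- If the set of non-leaf neighbours of `v₁` is not a singleton, it has two distinct members. -/
lemma CentralLevel.exists_two_nonleaf [Finite V] {T : SimpleGraph V} {v₁ v₂ : V} {h : V → ℕ}
    (hL : CentralLevel T v₁ v₂ h)
    (hc : ({u | h u = 1 ∧ ∃ w, h w = 0 ∧ T.Adj w u} : Set V).ncard ≠ 1) :
    ∃ u u' w w', u ≠ u' ∧ h w = 0 ∧ h w' = 0 ∧ T.Adj w u ∧ T.Adj w' u' := by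
  obtain ⟨w, hw⟩ := hL.exists_zero
  obtain ⟨u, hu, -⟩ := hL.parent_zero w hw
  have hmem : u ∈ {u | h u = 1 ∧ ∃ w, h w = 0 ∧ T.Adj w u} :=
    ⟨by have := hL.adj _ _ hu; omega, w, hw, hu⟩
  have hpos := (Set.ncard_pos (Set.toFinite _)).mpr ⟨u, hmem⟩
  have hlt : 1 < ({u | h u = 1 ∧ ∃ w, h w = 0 ∧ T.Adj w u} : Set V).ncard := by omega
  obtain ⟨u', ⟨-, w', hw', hu'⟩, hne⟩ := Set.exists_ne_of_one_lt_ncard hlt u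
  exact ⟨u, u', w, w', hne.symm, hw, hw', hu, hu'⟩

lemma CentralLevel.hubSetting {T : SimpleGraph V} {v₁ v₂ : V} {h s : V → ℕ}
    (hL : CentralLevel T v₁ v₂ h) (hs : ∀ v, 2 ≤ s v) (hs₁ : s v₁ = 2) (hs₂ : s v₂ = 2)
    (hc : ({u | h u = 1 ∧ ∃ w, h w = 0 ∧ T.Adj w u} : Set V).ncard = 1) :
    HubSetting T v₁ v₂ h s where
  level := hL
  mult := hs
  mult_left := hs₁
  mult_right := hs₂
  unique u u' w w' hw hw' hu hu' := by
    obtain ⟨z, hz⟩ := Set.ncard_eq_one.mp hc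
    have mem : ∀ {u w}, h w = 0 → T.Adj w u → u = z := fun {u w} hw hu => by
      have : u ∈ {u | h u = 1 ∧ ∃ w, h w = 0 ∧ T.Adj w u} :=
        ⟨by have := hL.adj _ _ hu; omega, w, hw, hu⟩
      rwa [hz] at this
    rw [mem hw hu, mem hw' hu']

/-- In a short orientation, the least multiplicity of a non-leaf neighbour of `v₁` exceeds `3`. -/
lemma ShortOrientation.four_le_sInf {T : SimpleGraph V} {v₁ v₂ : V} {h s : V → ℕ}
    {D : (Σ v : V, Fin (s v)) → (Σ v : V, Fin (s v)) → Prop}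
    (S : ShortOrientation T v₁ v₂ h s D) :
    4 ≤ sInf (s '' {u | h u = 1 ∧ ∃ w, h w = 0 ∧ T.Adj w u}) := by
  obtain ⟨w, hw⟩ := S.level.exists_zero
  obtain ⟨u, hu, -⟩ := S.level.parent_zero w hw
  have hmem : u ∈ {u | h u = 1 ∧ ∃ w, h w = 0 ∧ T.Adj w u} :=
    ⟨by have := S.level.adj _ _ hu; omega, w, hw, hu⟩
  refine le_csInf ⟨_, Set.mem_image_of_mem s hmem⟩ ?_
  rintro _ ⟨u', ⟨-, w', hw', hu'⟩, rfl⟩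
  exact S.four_le_mult hw' hu'

theorem stmt9 [Fintype V] (T : SimpleGraph V) (hT : T.IsTree) (hdiam : T.ediam = 5)
    (v₁ v₂ : V) (hadj : T.Adj v₁ v₂) (hecc₁ : ecc T v₁ = 3) (hecc₂ : ecc T v₂ = 3)
    (s : V → ℕ) (hs : ∀ v, 2 ≤ s v) (hs₁ : s v₁ = 2) (hs₂ : s v₂ = 2)
    (NL₁ NL₂ : Set V)
    (hNL₁ : NL₁ = {u : V | T.Adj v₁ u ∧ u ≠ v₂ ∧ (T.neighborSet u).ncard ≠ 1})
    (hNL₂ : NL₂ = {u : V | T.Adj v₂ u ∧ u ≠ v₁ ∧ (T.neighborSet u).ncard ≠ 1})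
    (m₁ m₂ : ℕ) (hm₁ : m₁ = sInf (s '' NL₁)) (hm₂ : m₂ = sInf (s '' NL₂))
    (hm : (2 ≤ m₁ ∧ m₁ ≤ 3) ∨ (2 ≤ m₂ ∧ m₂ ≤ 3)) :
    orientNum (vertexMult T s) = 5 ↔ NL₁.ncard = 1 ∨ NL₂.ncard = 1 := by
  obtain ⟨h, hL⟩ := exists_centralLevel hT hadj hecc₁ hecc₂
  rw [hL.nonleaf_left_eq] at hNL₁
  rw [hL.swap.nonleaf_left_eq] at hNL₂
  subst hNL₁ hNL₂ hm₁ hm₂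
  constructor
  · intro hnum
    by_contra! hcard
    have hne : {d : ℕ∞ | ∃ D, IsStrongOrientation (vertexMult T s) D ∧ d = odiam D}.Nonempty := by
      by_contra hemp
      rw [orientNum, Set.not_nonempty_iff_eq_empty.mp hemp, sInf_empty] at hnum
      exact absurd hnum (by decide)
    obtain ⟨D, hD, hdD⟩ := csInf_mem hne
    have hle : odiam D ≤ (5 : ℕ) := (hdD.symm.trans hnum).le
    have S : ShortOrientation T v₁ v₂ h s D :=
      { level := hL
        mult := hs
        mult_left := hs₁
        mult_right := hs₂
        orient := hD.1
        short := odiam_le_iff.mp hle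
        left := hL.exists_two_nonleaf hcard.1
        right := by
          obtain ⟨u, u', w, w', hne, hw, hw', ha, ha'⟩ := hL.swap.exists_two_nonleaf hcard.2
          have := hL.le_five w
          have := hL.le_five w'
          exact ⟨u, u', w, w', hne, by omega, by omega, ha, ha'⟩ }
    have h₁ := S.four_le_sInf
    have h₂ := S.swap.four_le_sInf
    omega
  · rintro (hc | hc)
    · exact (hL.hubSetting hs hs₁ hs₂ hc).orientNum_eq
    · exact (hL.swap.hubSetting hs hs₂ hs₁ hc).orientNum_eq
end
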